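/- Let (c_λ)_{λ∈Q} be an admissible family with values in F = ℚ(q,t), and set X = (1 − t^{−1})/(1 − q·t^{ht(θ)}). Then for every short root λ one has c_λ = t^{ht(λ)+D_λ}·X + (t^{ht(λ)} − t^{ht(λ)+D_λ}). -/

import Mathlib

open scoped RealInnerProductSpace

attribute [local instance] Classical.propDecidable

noncomputable section

/-- The reflection in the hyperplane orthogonal to `α`. -/
def sref {V : Type*} [NormedAddCommGroup V] [InnerProductSpace ℝ V] (α x : V) : V :=
  x - (2 * ⟪x, α⟫ / ⟪α, α⟫) • α

/-- The coroot `α^∨ = 2α/(α,α)`. -/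
def coroot {V : Type*} [NormedAddCommGroup V] [InnerProductSpace ℝ V] (α : V) : V :=
  (2 / ⟪α, α⟫) • α

/-- The data of a finite reduced irreducible crystallographic root system `R` in a real
inner product space, together with a fixed choice of positive roots and simple roots. -/
structure RSD (V : Type*) [NormedAddCommGroup V] [InnerProductSpace ℝ V] where
  R : Finset V
  Rpos : Finset V
  n : ℕ
  npos : 0 < n
  simple : Fin n → V
  simple_mem : ∀ i, simple i ∈ Rpos
  pos_sub : Rpos ⊆ R
  root_ne_zero : ∀ α ∈ R, α ≠ 0
  pos_or_neg : ∀ α ∈ R, α ∈ Rpos ∨ -α ∈ Rpos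
  not_both : ∀ α ∈ Rpos, -α ∉ Rpos
  pos_combo : ∀ α ∈ Rpos, ∃ c : Fin n → ℕ, α = ∑ i, (c i : ℝ) • simple i
  simple_indep : LinearIndependent ℝ simple
  reduced : ∀ α ∈ R, ∀ c : ℝ, c • α ∈ R → c = 1 ∨ c = -1
  crystal : ∀ α ∈ R, ∀ β ∈ R, ∃ k : ℤ, ⟪β, coroot α⟫ = (k : ℝ)
  refl_mem : ∀ α ∈ R, ∀ β ∈ R, sref α β ∈ R
  spanning : Submodule.span ℝ (R : Set V) = ⊤
  irred : ∀ s : Set V, (∀ α ∈ R, ∀ β ∈ R, α ∈ s → β ∉ s → ⟪α, β⟫ = 0) →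
    (∀ α ∈ R, α ∈ s) ∨ (∀ α ∈ R, α ∉ s)

namespace RSD

variable {V : Type*} [NormedAddCommGroup V] [InnerProductSpace ℝ V]

/-- The map of `V` determined by a word in the simple reflections. -/
def wordMap (S : RSD V) (l : List (Fin S.n)) : V → V :=
  l.foldr (fun i f => sref (S.simple i) ∘ f) id

/-- `w : V → V` is an element of the Weyl group `W`, i.e. a product of simple reflections. -/
def IsWeyl (S : RSD V) (w : V → V) : Prop := ∃ l : List (Fin S.n), w = S.wordMap l

/-- The length `ℓ(w)` of a Weyl group element: the smallest length of a word in the simple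
reflections representing `w`. -/
def len (S : RSD V) (w : V → V) : ℕ :=
  sInf {k | ∃ l : List (Fin S.n), l.length = k ∧ w = S.wordMap l}

/-- `x` and `y` lie in the same Weyl group orbit. -/
def sameOrbit (S : RSD V) (x y : V) : Prop := ∃ w, S.IsWeyl w ∧ w x = y

/-- `x` is dominant: `(x, α_i) ≥ 0` for all simple roots. -/
def Dominant (S : RSD V) (x : V) : Prop := ∀ i, 0 ≤ ⟪x, S.simple i⟫

/-- `w` is a Weyl group element of minimal length among those sending `x` to `y`. -/
def IsMinWord (S : RSD V) (x y : V) (w : V → V) : Prop :=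
  S.IsWeyl w ∧ w x = y ∧ ∀ w' : V → V, S.IsWeyl w' → w' x = y → S.len w ≤ S.len w'

/-- Membership in the root lattice `Q`, the ℤ-span of the simple roots. -/
def inQ (S : RSD V) (x : V) : Prop :=
  ∃ c : Fin S.n → ℤ, x = ∑ i, (c i : ℝ) • S.simple i

/-- The height `ht(λ) = Σ a_i` of an element `λ = Σ a_i α_i` of the root lattice
(the coefficients are unique since the simple roots are linearly independent). -/
def htZ (S : RSD V) (x : V) : ℤ :=
  if h : ∃ c : Fin S.n → ℤ, x = ∑ i, (c i : ℝ) • S.simple i then ∑ i, h.choose i else 0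

/-- The inversion set `Π(w) = {α ∈ R⁺ : w(α) ∈ R⁻}`. -/
def PiSet (S : RSD V) (w : V → V) : Finset V :=
  S.Rpos.filter (fun α => -(w α) ∈ S.Rpos)

/-- `α` is a short root (if all roots have the same length, all roots are short). -/
def IsShort (S : RSD V) (α : V) : Prop :=
  α ∈ S.R ∧ ∀ β ∈ S.R, ⟪α, α⟫ ≤ ⟪β, β⟫

/-- `α` is a long root. -/
def IsLong (S : RSD V) (α : V) : Prop :=
  α ∈ S.R ∧ ∀ β ∈ S.R, ⟪β, β⟫ ≤ ⟪α, α⟫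

/-- The short roots in the inversion set `Π(w)`. -/
def PiS (S : RSD V) (w : V → V) : Finset V :=
  (S.PiSet w).filter (fun α => S.IsShort α)

/-- The long roots in the inversion set `Π(w)`. -/
def PiL (S : RSD V) (w : V → V) : Finset V :=
  (S.PiSet w).filter (fun α => S.IsLong α)

end RSD


/-- The field `F = ℚ(q,t)` of rational functions in two variables over `ℚ`. -/
abbrev FF : Type := FractionRing (MvPolynomial (Fin 2) ℚ)

/-- The variable `q` of `ℚ(q,t)`. -/
def qq : FF := algebraMap (MvPolynomial (Fin 2) ℚ) FF (MvPolynomial.X 0)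

/-- The variable `t` of `ℚ(q,t)`. -/
def tt : FF := algebraMap (MvPolynomial (Fin 2) ℚ) FF (MvPolynomial.X 1)

/-- A family `(c_λ)_{λ∈Q}` of elements of `F = ℚ(q,t)` is admissible if `c_0 = 1` and it
satisfies Cherednik's relations: (i) for every `λ ∈ Q` and simple root `α_i` with
`k = (λ, α_i^∨) > 0`, `t·c_{s_i(λ)} − c_λ = (1−t)·(c_{λ−α_i} + ⋯ + c_{λ−(k−1)α_i})`;
(ii) for every `λ ∈ Q` with `k = (λ, θ^∨) > 0` (`θ` the highest root),
`t·q^k·c_λ − c_{s_θ(λ)} = (1−t)·(q^{k−1}c_{λ−θ} + ⋯ + q·c_{λ−(k−1)θ})`. -/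
def Admissible {V : Type*} [NormedAddCommGroup V] [InnerProductSpace ℝ V]
    (S : RSD V) (θ : V) (c : V → FF) : Prop :=
  c 0 = 1 ∧
  (∀ lam : V, S.inQ lam → ∀ i : Fin S.n, ∀ k : ℕ, 0 < k →
      ⟪lam, coroot (S.simple i)⟫ = (k : ℝ) →
      tt * c (sref (S.simple i) lam) - c lam
        = (1 - tt) * ∑ j ∈ Finset.Ico 1 k, c (lam - (j : ℝ) • S.simple i)) ∧
  (∀ lam : V, S.inQ lam → ∀ k : ℕ, 0 < k → ⟪lam, coroot θ⟫ = (k : ℝ) →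
      tt * qq ^ k * c lam - c (sref θ lam)
        = (1 - tt) * ∑ j ∈ Finset.Ico 1 k, qq ^ (k - j) * c (lam - (j : ℝ) • θ))

namespace RSD

variable {V : Type*} [NormedAddCommGroup V] [InnerProductSpace ℝ V]

lemma mem_span_simple_of_pos (S : RSD V) {α : V} (hα : α ∈ S.Rpos) :
    α ∈ Submodule.span ℝ (Set.range S.simple) := by
  obtain ⟨c, rfl⟩ := S.pos_combo α hα
  exact Submodule.sum_mem _ fun i _ =>
    Submodule.smul_mem _ _ (Submodule.subset_span ⟨i, rfl⟩)

lemma top_le_span_simple (S : RSD V) : ⊤ ≤ Submodule.span ℝ (Set.range S.simple) := by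
  rw [← S.spanning, Submodule.span_le]
  intro α hα
  rcases S.pos_or_neg α hα with h | h
  · exact S.mem_span_simple_of_pos h
  · simpa using Submodule.neg_mem _ (S.mem_span_simple_of_pos h)

/-- The simple roots, as a basis of the ambient space. -/
def basis (S : RSD V) : Module.Basis (Fin S.n) ℝ V :=
  Module.Basis.mk S.simple_indep S.top_le_span_simple

lemma basis_apply (S : RSD V) (i : Fin S.n) : S.basis i = S.simple i := by
  simp [basis]

/-- The coefficient of `α_i` in the expansion of a vector in the simple roots. -/
def coef (S : RSD V) (i : Fin S.n) : V →ₗ[ℝ] ℝ := S.basis.coord i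

lemma coef_simple (S : RSD V) (i j : Fin S.n) :
    S.coef i (S.simple j) = if j = i then 1 else 0 := by
  rw [← S.basis_apply, coef, Module.Basis.coord_apply, Module.Basis.repr_self,
    Finsupp.single_apply]

lemma sum_coef (S : RSD V) (x : V) : ∑ i, S.coef i x • S.simple i = x := by
  simpa [coef, basis_apply] using S.basis.sum_repr x

lemma coef_sum (S : RSD V) (c : Fin S.n → ℝ) (i : Fin S.n) :
    S.coef i (∑ j, c j • S.simple j) = c i := by
  simp [coef_simple]

lemma inner_eq_sum_coef (S : RSD V) (x y : V) :
    ⟪x, y⟫ = ∑ i, S.coef i x * ⟪S.simple i, y⟫ := by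
  conv_lhs => rw [← S.sum_coef x]
  simp [sum_inner, real_inner_smul_left]

lemma coe_htZ (S : RSD V) {x : V} (hx : S.inQ x) : (S.htZ x : ℝ) = ∑ i, S.coef i x := by
  have hx' : ∃ c : Fin S.n → ℤ, x = ∑ i, (c i : ℝ) • S.simple i := hx
  rw [htZ, dif_pos hx']
  have h := hx'.choose_spec
  push_cast
  refine Finset.sum_congr rfl fun i _ => ?_
  conv_rhs => rw [h]
  rw [coef_sum]

lemma simple_mem_R (S : RSD V) (i : Fin S.n) : S.simple i ∈ S.R := S.pos_sub (S.simple_mem i)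

lemma inQ_of_pos (S : RSD V) {α : V} (hα : α ∈ S.Rpos) : S.inQ α := by
  obtain ⟨c, hc⟩ := S.pos_combo α hα
  exact ⟨fun i => c i, by simpa using hc⟩

lemma inQ_of_root (S : RSD V) {α : V} (hα : α ∈ S.R) : S.inQ α := by
  rcases S.pos_or_neg α hα with h | h
  · exact S.inQ_of_pos h
  · obtain ⟨c, hc⟩ := S.pos_combo _ h
    refine ⟨fun i => -(c i : ℤ), ?_⟩
    rw [← neg_neg α, hc]
    simp

lemma inner_self_pos (S : RSD V) {α : V} (hα : α ∈ S.R) : 0 < ⟪α, α⟫ :=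
  real_inner_self_pos.2 (S.root_ne_zero α hα)

lemma coef_nonneg (S : RSD V) {α : V} (hα : α ∈ S.Rpos) (i : Fin S.n) : 0 ≤ S.coef i α := by
  obtain ⟨c, hc⟩ := S.pos_combo α hα
  rw [hc, coef_sum]
  positivity

lemma pos_of_coef_pos (S : RSD V) {α : V} (hα : α ∈ S.R) {i : Fin S.n}
    (h : 0 < S.coef i α) : α ∈ S.Rpos := by
  refine (S.pos_or_neg α hα).resolve_right fun hn => ?_
  have := S.coef_nonneg hn i
  rw [map_neg] at this
  linarith

lemma coef_sref (S : RSD V) (i j : Fin S.n) (x : V) (h : i ≠ j) :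
    S.coef j (sref (S.simple i) x) = S.coef j x := by
  simp [sref, coef_simple, h]

lemma inner_sref_sref (α x y : V) (hα : α ≠ 0) :
    ⟪sref α x, sref α y⟫ = ⟪x, y⟫ := by
  have h : ⟪α, α⟫ ≠ 0 := (real_inner_self_pos.2 hα).ne'
  simp only [sref, inner_sub_left, inner_sub_right, real_inner_smul_left,
    real_inner_smul_right, real_inner_comm y α]
  field_simp
  ring

lemma inner_sref_self (α x : V) (hα : α ≠ 0) : ⟪sref α x, α⟫ = -⟪x, α⟫ := by
  have h : ⟪α, α⟫ ≠ 0 := (real_inner_self_pos.2 hα).ne'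
  simp only [sref, inner_sub_left, real_inner_smul_left]
  field_simp
  ring

lemma sref_sref (α x : V) (hα : α ≠ 0) : sref α (sref α x) = x := by
  conv_lhs => rw [sref, inner_sref_self α x hα]
  rw [sref]
  module

lemma sref_of_inner_eq_zero {α x : V} (h : ⟪x, α⟫ = 0) : sref α x = x := by
  simp [sref, h]

lemma simple_ne_zero (S : RSD V) (i : Fin S.n) : S.simple i ≠ 0 :=
  S.root_ne_zero _ (S.simple_mem_R i)

lemma isShort_sref (S : RSD V) {μ α : V} (hμ : S.IsShort μ) (hα : α ∈ S.R) :
    S.IsShort (sref α μ) :=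
  ⟨S.refl_mem α hα μ hμ.1, fun β hβ => by
    rw [inner_sref_sref _ _ _ (S.root_ne_zero α hα)]
    exact hμ.2 β hβ⟩

lemma isShort_wordMap (S : RSD V) {μ : V} (hμ : S.IsShort μ) (l : List (Fin S.n)) :
    S.IsShort (S.wordMap l μ) := by
  induction l with
  | nil => exact hμ
  | cons i l ih => exact S.isShort_sref ih (S.simple_mem_R i)

/-- The simple reflection `s_i` permutes the positive roots other than `α_i`. -/
lemma sref_simple_mem_pos (S : RSD V) {β : V} (hβ : β ∈ S.Rpos) (i : Fin S.n)
    (hne : β ≠ S.simple i) : sref (S.simple i) β ∈ S.Rpos := by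
  have hR := S.refl_mem _ (S.simple_mem_R i) _ (S.pos_sub hβ)
  by_contra hcon
  have hzero : ∀ j, i ≠ j → S.coef j β = 0 := fun j hj => by
    by_contra h0
    refine hcon (S.pos_of_coef_pos hR (i := j) ?_)
    rw [S.coef_sref i j β hj]
    exact lt_of_le_of_ne (S.coef_nonneg hβ j) (Ne.symm h0)
  have hβ' : β = S.coef i β • S.simple i := by
    conv_lhs => rw [← S.sum_coef β]
    exact Finset.sum_eq_single i (fun j _ hj => by rw [hzero j hj.symm, zero_smul]) (by simp)
  rcases S.reduced _ (S.simple_mem_R i) (S.coef i β) (hβ' ▸ S.pos_sub hβ) with h | h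
  · exact hne (by rw [hβ', h, one_smul])
  · have := S.coef_nonneg hβ i
    linarith

lemma exists_inner_simple_pos (S : RSD V) {β : V} (hβ : β ∈ S.Rpos) :
    ∃ i, 0 < ⟪β, S.simple i⟫ := by
  by_contra! h
  have hpos := S.inner_self_pos (S.pos_sub hβ)
  rw [S.inner_eq_sum_coef] at hpos
  refine hpos.not_ge (Finset.sum_nonpos fun i _ => ?_)
  rw [real_inner_comm]
  exact mul_nonpos_of_nonneg_of_nonpos (S.coef_nonneg hβ i) (h i)

lemma pos_of_dominant (S : RSD V) {β : V} (hβ : β ∈ S.R) (hd : S.Dominant β) :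
    β ∈ S.Rpos := by
  refine (S.pos_or_neg β hβ).resolve_right fun h => ?_
  obtain ⟨i, hi⟩ := S.exists_inner_simple_pos h
  have := hd i
  rw [inner_neg_left] at hi
  linarith

lemma inner_simple_nonpos (S : RSD V) {i j : Fin S.n} (hij : i ≠ j) :
    ⟪S.simple i, S.simple j⟫ ≤ 0 := by
  by_contra! h
  have hne : S.simple i ≠ S.simple j := fun h => hij (S.simple_indep.injective h)
  have hpos := S.sref_simple_mem_pos (S.simple_mem i) j hne
  have hc := S.coef_nonneg hpos j
  have hjj := S.inner_self_pos (S.simple_mem_R j)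
  have : 0 < 2 * ⟪S.simple i, S.simple j⟫ / ⟪S.simple j, S.simple j⟫ := by positivity
  simp only [sref, map_sub, map_smul, coef_simple, hij, if_true, if_false, smul_eq_mul,
    mul_one] at hc
  linarith

lemma exists_int_cartan (S : RSD V) {α β : V} (hα : α ∈ S.R) (hβ : β ∈ S.R) :
    ∃ k : ℤ, 2 * ⟪β, α⟫ / ⟪α, α⟫ = k := by
  obtain ⟨k, hk⟩ := S.crystal α hα β hβ
  refine ⟨k, ?_⟩
  rw [← hk, coroot, real_inner_smul_right]
  ring

lemma htZ_sref (S : RSD V) {μ α : V} (hμ : μ ∈ S.R) (hα : α ∈ S.R) {k : ℤ}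
    (hk : 2 * ⟪μ, α⟫ / ⟪α, α⟫ = k) : S.htZ (sref α μ) = S.htZ μ - k * S.htZ α := by
  have h1 := S.coe_htZ (S.inQ_of_root (S.refl_mem α hα μ hμ))
  simp only [sref, hk, map_sub, map_smul, smul_eq_mul, Finset.sum_sub_distrib, ← Finset.mul_sum,
    ← S.coe_htZ (S.inQ_of_root hμ), ← S.coe_htZ (S.inQ_of_root hα)] at h1
  rw [sref, hk]
  exact_mod_cast h1

lemma htZ_simple (S : RSD V) (i : Fin S.n) : S.htZ (S.simple i) = 1 := by
  have h := S.coe_htZ (S.inQ_of_root (S.simple_mem_R i))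
  simp only [coef_simple, Finset.sum_ite_eq, Finset.mem_univ, if_true] at h
  exact_mod_cast h

lemma htZ_sref_simple (S : RSD V) {μ : V} (hμ : μ ∈ S.R) (i : Fin S.n) {k : ℤ}
    (hk : 2 * ⟪μ, S.simple i⟫ / ⟪S.simple i, S.simple i⟫ = k) :
    S.htZ (sref (S.simple i) μ) = S.htZ μ - k := by
  rw [S.htZ_sref hμ (S.simple_mem_R i) hk, htZ_simple, mul_one]

lemma htZ_pos (S : RSD V) {β : V} (hβ : β ∈ S.Rpos) : 0 < S.htZ β := by
  have h := S.coe_htZ (S.inQ_of_pos hβ)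
  have h0 : 0 ≤ ∑ i, S.coef i β := Finset.sum_nonneg fun i _ => S.coef_nonneg hβ i
  refine lt_of_le_of_ne (by exact_mod_cast h ▸ h0) fun h1 => ?_
  rw [← h1, Int.cast_zero] at h
  have hz := (Finset.sum_eq_zero_iff_of_nonneg fun i _ => S.coef_nonneg hβ i).1 h.symm
  refine S.root_ne_zero β (S.pos_sub hβ) ?_
  rw [← S.sum_coef β]
  exact Finset.sum_eq_zero fun i hi => by rw [hz i hi, zero_smul]

/-- If the simple roots indexed by `K` are orthogonal to the remaining ones, every positive root
is supported on `K` or on its complement. -/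
lemma support_dichotomy (S : RSD V) (K : Set (Fin S.n))
    (hK : ∀ i ∈ K, ∀ j ∉ K, ⟪S.simple i, S.simple j⟫ = 0) (β : V) (hβ : β ∈ S.Rpos) :
    (∀ i ∉ K, S.coef i β = 0) ∨ (∀ i ∈ K, S.coef i β = 0) := by
  induction hm : (S.htZ β).toNat using Nat.strong_induction_on generalizing β with
  | _ m ih =>
    obtain ⟨i, hi⟩ := S.exists_inner_simple_pos hβ
    by_cases hβi : β = S.simple i
    · subst hβi
      by_cases hiK : i ∈ K
      · exact Or.inl fun j hj => by
          rw [coef_simple, if_neg (by rintro rfl; exact hj hiK)]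
      · exact Or.inr fun j hj => by
          rw [coef_simple, if_neg (by rintro rfl; exact hiK hj)]
    have hpos := S.sref_simple_mem_pos hβ i hβi
    obtain ⟨k, hk⟩ := S.exists_int_cartan (S.simple_mem_R i) (S.pos_sub hβ)
    have hht := S.htZ_sref_simple (S.pos_sub hβ) i hk
    have hk0 : 0 < k := by
      have hii := S.inner_self_pos (S.simple_mem_R i)
      have : (0 : ℝ) < k := by rw [← hk]; positivity
      exact_mod_cast this
    have h1 := S.htZ_pos hpos
    have h2 := S.htZ_pos hβ
    have hinner : ⟪sref (S.simple i) β, S.simple i⟫ ≠ 0 := by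
      rw [inner_sref_self _ _ (S.simple_ne_zero i)]
      linarith
    rw [S.inner_eq_sum_coef] at hinner
    rcases ih _ (by omega) _ hpos rfl with h | h
    · by_cases hiK : i ∈ K
      · refine Or.inl fun j hj => ?_
        rw [← S.coef_sref i j β (by rintro rfl; exact hj hiK), h j hj]
      · refine absurd (Finset.sum_eq_zero fun j _ => ?_) hinner
        by_cases hjK : j ∈ K
        · rw [hK j hjK i hiK, mul_zero]
        · rw [h j hjK, zero_mul]
    · by_cases hiK : i ∈ K
      · refine absurd (Finset.sum_eq_zero fun j _ => ?_) hinner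
        by_cases hjK : j ∈ K
        · rw [h j hjK, zero_mul]
        · rw [real_inner_comm, hK i hiK j hjK, mul_zero]
      · refine Or.inr fun j hj => ?_
        rw [← S.coef_sref i j β (by rintro rfl; exact hiK hj), h j hj]

lemma support_dichotomy_root (S : RSD V) (K : Set (Fin S.n))
    (hK : ∀ i ∈ K, ∀ j ∉ K, ⟪S.simple i, S.simple j⟫ = 0) (β : V) (hβ : β ∈ S.R) :
    (∀ i ∉ K, S.coef i β = 0) ∨ (∀ i ∈ K, S.coef i β = 0) := by
  rcases S.pos_or_neg β hβ with h | h
  · exact S.support_dichotomy K hK β h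
  · simpa using S.support_dichotomy K hK _ h

/-- A dominant root has full support. -/
lemma coef_pos_of_dominant (S : RSD V) {μ : V} (hμ : μ ∈ S.R) (hd : S.Dominant μ)
    (i : Fin S.n) : 0 < S.coef i μ := by
  have hpos := S.pos_of_dominant hμ hd
  set K : Set (Fin S.n) := {i | S.coef i μ ≠ 0}
  have hK : ∀ i ∈ K, ∀ j ∉ K, ⟪S.simple i, S.simple j⟫ = 0 := by
    intro i hi j hj
    have hj' : S.coef j μ = 0 := by simpa [K] using hj
    have hterm : ∀ l ∈ Finset.univ, S.coef l μ * ⟪S.simple l, S.simple j⟫ ≤ 0 := fun l _ => by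
      by_cases hl : l = j
      · rw [hl, hj', zero_mul]
      · exact mul_nonpos_of_nonneg_of_nonpos (S.coef_nonneg hpos l) (S.inner_simple_nonpos hl)
    have hsum : ∑ l, S.coef l μ * ⟪S.simple l, S.simple j⟫ = 0 :=
      le_antisymm (Finset.sum_nonpos hterm) (by rw [← S.inner_eq_sum_coef]; exact hd j)
    exact (mul_eq_zero.1 ((Finset.sum_eq_zero_iff_of_nonpos hterm).1 hsum i
      (Finset.mem_univ i))).resolve_left hi
  have hirr := S.irred {x | ∀ i ∉ K, S.coef i x = 0} fun α _ β hβ hαs hβs => by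
    have hβ0 := (S.support_dichotomy_root K hK β hβ).resolve_left hβs
    rw [S.inner_eq_sum_coef]
    refine Finset.sum_eq_zero fun l _ => ?_
    by_cases hl : l ∈ K
    · rw [real_inner_comm, S.inner_eq_sum_coef, Finset.sum_eq_zero, mul_zero]
      intro m _
      by_cases hm : m ∈ K
      · rw [hβ0 m hm, zero_mul]
      · rw [real_inner_comm, hK l hl m hm, mul_zero]
    · rw [hαs l hl, zero_mul]
  have hall := hirr.resolve_right fun h => h μ hμ fun i hi => by simpa [K] using hi
  refine lt_of_le_of_ne (S.coef_nonneg hpos i) fun h0 => ?_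
  have h1 := hall _ (S.simple_mem_R i) i (by simp [K, ← h0])
  simp [coef_simple] at h1

lemma inner_pos_of_dominant (S : RSD V) {μ ν : V} (hμ : μ ∈ S.R) (hν : ν ∈ S.R)
    (hdμ : S.Dominant μ) (hdν : S.Dominant ν) : 0 < ⟪μ, ν⟫ := by
  rw [S.inner_eq_sum_coef]
  obtain ⟨i, hi⟩ := S.exists_inner_simple_pos (S.pos_of_dominant hν hdν)
  refine Finset.sum_pos' (fun j _ => ?_) ⟨i, Finset.mem_univ i, ?_⟩
  · rw [real_inner_comm]
    exact mul_nonneg (S.coef_pos_of_dominant hμ hdμ j).le (hdν j)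
  · rw [real_inner_comm]
    exact mul_pos (S.coef_pos_of_dominant hμ hdμ i) hi

lemma inner_nonneg_of_dominant (S : RSD V) {μ β : V} (hd : S.Dominant μ) (hβ : β ∈ S.Rpos) :
    0 ≤ ⟪μ, β⟫ := by
  rw [real_inner_comm, S.inner_eq_sum_coef]
  refine Finset.sum_nonneg fun i _ => ?_
  rw [real_inner_comm]
  exact mul_nonneg (S.coef_nonneg hβ i) (hd i)

/-- The positive Cartan integers `(μ, α^∨)` for a short root `μ` are `1`, or `2` when `μ = α`. -/
lemma cartan_of_isShort (S : RSD V) {μ α : V} (hμ : S.IsShort μ) (hα : α ∈ S.R)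
    (h : 0 < ⟪μ, α⟫) :
    2 * ⟪μ, α⟫ / ⟪α, α⟫ = 1 ∨ (μ = α ∧ 2 * ⟪μ, α⟫ / ⟪α, α⟫ = 2) := by
  have hαα := S.inner_self_pos hα
  by_cases hμα : μ = α
  · subst hμα
    exact Or.inr ⟨rfl, by field_simp⟩
  obtain ⟨k, hk⟩ := S.exists_int_cartan hα hμ.1
  have hk0 : 0 < k := by
    have : (0 : ℝ) < k := by rw [← hk]; positivity
    exact_mod_cast this
  have hk2 : k < 2 := by
    by_contra! hk2
    have hk2' : (2 : ℝ) ≤ k := by exact_mod_cast hk2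
    rw [← hk, le_div_iff₀ hαα] at hk2'
    have hle := hμ.2 α hα
    have hpos : 0 < ⟪μ - α, μ - α⟫ := real_inner_self_pos.2 (sub_ne_zero.2 hμα)
    rw [inner_sub_left, inner_sub_right, inner_sub_right, real_inner_comm μ α] at hpos
    linarith
  left
  rw [hk, show k = 1 by omega, Int.cast_one]

lemma eq_of_dominant_of_isShort (S : RSD V) {μ ν : V} (hμ : S.IsShort μ) (hν : S.IsShort ν)
    (hdμ : S.Dominant μ) (hdν : S.Dominant ν) : μ = ν := by
  have hin := S.inner_pos_of_dominant hμ.1 hν.1 hdμ hdν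
  rcases S.cartan_of_isShort hμ hν.1 hin with h | h
  · have hnorm : ⟪μ, μ⟫ = ⟪ν, ν⟫ := le_antisymm (hμ.2 ν hν.1) (hν.2 μ hμ.1)
    have hνν := S.inner_self_pos hν.1
    have hroot := S.refl_mem ν hν.1 μ hμ.1
    rw [sref, h, one_smul] at hroot
    rw [div_eq_one_iff_eq hνν.ne'] at h
    rcases S.pos_or_neg _ hroot with hp | hp
    · have := S.inner_nonneg_of_dominant hdν hp
      rw [inner_sub_right, real_inner_comm] at this
      linarith
    · have := S.inner_nonneg_of_dominant hdμ hp
      rw [inner_neg_right, inner_sub_right] at this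
      linarith
  · exact h.1

/-- The height of a root, shifted by one on negative roots: a simple reflection changes it by at
most one on short roots. -/
def adjHt (S : RSD V) (x : V) : ℤ := S.htZ x + if x ∈ S.Rpos then 0 else 1

lemma sref_simple_mem_pos_iff (S : RSD V) {β : V} (i : Fin S.n)
    (h1 : β ≠ S.simple i) (h2 : β ≠ -S.simple i) :
    sref (S.simple i) β ∈ S.Rpos ↔ β ∈ S.Rpos := by
  refine ⟨fun h => ?_, fun h => S.sref_simple_mem_pos h i h1⟩
  have hne : sref (S.simple i) β ≠ S.simple i := fun heq => h2 <| by
    rw [← sref_sref _ β (S.simple_ne_zero i), heq, sref,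
      mul_div_assoc, div_self (S.inner_self_pos (S.simple_mem_R i)).ne']
    module
  have := S.sref_simple_mem_pos h i hne
  rwa [sref_sref _ _ (S.simple_ne_zero i)] at this

/-- On a short root in the open positive half-space of `α_i`, the reflection `s_i` lowers the
adjusted height by one. -/
lemma adjHt_sref (S : RSD V) {μ : V} (hμ : S.IsShort μ) (i : Fin S.n)
    (h : 0 < ⟪μ, S.simple i⟫) : S.adjHt (sref (S.simple i) μ) = S.adjHt μ - 1 := by
  rcases S.cartan_of_isShort hμ (S.simple_mem_R i) h with hk | ⟨rfl, hk⟩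
  · have hht := S.htZ_sref_simple hμ.1 i (k := 1) (by simpa using hk)
    have hii := S.inner_self_pos (S.simple_mem_R i)
    have h1 : μ ≠ S.simple i := by
      rintro rfl
      rw [mul_div_assoc, div_self hii.ne'] at hk
      norm_num at hk
    have h2 : μ ≠ -S.simple i := by
      rintro rfl
      rw [inner_neg_left] at h
      linarith
    simp only [adjHt, S.sref_simple_mem_pos_iff i h1 h2, hht]
    ring
  · have hht := S.htZ_sref_simple hμ.1 i (k := 2) (by simpa using hk)
    have hneg : sref (S.simple i) (S.simple i) ∉ S.Rpos := by
      have hrefl : sref (S.simple i) (S.simple i) = -S.simple i := by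
        rw [sref, hk]
        module
      rw [hrefl]
      exact S.not_both _ (S.simple_mem i)
    rw [adjHt, adjHt, if_neg hneg, if_pos (S.simple_mem i), hht]
    ring

lemma adjHt_le_adjHt_sref_add_one (S : RSD V) {μ : V} (hμ : S.IsShort μ) (i : Fin S.n) :
    S.adjHt μ ≤ S.adjHt (sref (S.simple i) μ) + 1 := by
  rcases lt_trichotomy ⟪μ, S.simple i⟫ 0 with h | h | h
  · have := S.adjHt_sref (S.isShort_sref hμ (S.simple_mem_R i)) i
      (by rw [inner_sref_self _ _ (S.simple_ne_zero i)]; linarith)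
    rw [sref_sref _ _ (S.simple_ne_zero i)] at this
    omega
  · rw [sref_of_inner_eq_zero h]
    omega
  · rw [S.adjHt_sref hμ i h]
    omega

lemma adjHt_le_adjHt_wordMap_add_length (S : RSD V) {μ : V} (hμ : S.IsShort μ)
    (l : List (Fin S.n)) : S.adjHt μ ≤ S.adjHt (S.wordMap l μ) + l.length := by
  induction l with
  | nil => simp [wordMap]
  | cons i l ih =>
    have h := S.adjHt_le_adjHt_sref_add_one (S.isShort_wordMap hμ l) i
    have hcons : S.wordMap (i :: l) μ = sref (S.simple i) (S.wordMap l μ) := rfl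
    rw [hcons, List.length_cons]
    push_cast
    omega

/-- Every short root is obtained from the dominant short root `ν` by a chain of simple reflections
each of which lowers the adjusted height by one; a function scaled by `t` along such steps is
therefore determined by its value at `ν`. -/
lemma exists_word_of_isShort (S : RSD V) {F : Type*} [Field F] {t : F} (ht : t ≠ 0)
    (f : V → F)
    (hf : ∀ μ, S.IsShort μ → ∀ i, 0 < ⟪μ, S.simple i⟫ → t * f (sref (S.simple i) μ) = f μ)
    {H : ℤ} (hH : ∀ α ∈ S.R, S.htZ α ≤ H) {ν : V} (hν : S.IsShort ν) (hdν : S.Dominant ν)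
    {μ : V} (hμ : S.IsShort μ) :
    ∃ l : List (Fin S.n), S.wordMap l ν = μ ∧ (l.length : ℤ) = S.adjHt ν - S.adjHt μ ∧
      f μ = t ^ (S.adjHt μ - S.adjHt ν) * f ν := by
  induction hm : (H + 2 - S.adjHt μ).toNat using Nat.strong_induction_on generalizing μ with
  | _ m ih =>
    by_cases hd : S.Dominant μ
    · obtain rfl := S.eq_of_dominant_of_isShort hμ hν hd hdν
      exact ⟨[], rfl, by simp, by simp⟩
    · simp only [Dominant, not_forall, not_le] at hd
      obtain ⟨i, hi⟩ := hd
      have hs := S.isShort_sref hμ (S.simple_mem_R i)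
      have hpos : 0 < ⟪sref (S.simple i) μ, S.simple i⟫ := by
        rw [inner_sref_self _ _ (S.simple_ne_zero i)]
        linarith
      have hadj := S.adjHt_sref hs i hpos
      have hfs := hf _ hs i hpos
      rw [sref_sref _ _ (S.simple_ne_zero i)] at hadj hfs
      have hbound : S.adjHt μ ≤ H + 1 := by
        have := hH μ hμ.1
        rw [adjHt]
        split_ifs <;> omega
      have hlt : (H + 2 - S.adjHt (sref (S.simple i) μ)).toNat < m := by omega
      obtain ⟨l, hl, hlen, hfl⟩ := ih _ hlt hs rfl
      refine ⟨i :: l, ?_, ?_, ?_⟩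
      · have hcons : S.wordMap (i :: l) ν = sref (S.simple i) (S.wordMap l ν) := rfl
        rw [hcons, hl, sref_sref _ _ (S.simple_ne_zero i)]
      · rw [List.length_cons]
        push_cast
        omega
      · refine mul_left_cancel₀ ht ?_
        rw [hfs, hfl, ← mul_assoc, ← zpow_one_add₀ ht]
        congr 2
        rw [hadj]
        ring

end RSD

lemma tt_ne_zero : tt ≠ 0 := by
  simp [tt]

/-- A monomial `q·t^m` is never a constant. -/
lemma qq_mul_tt_pow_ne_C (m : ℕ) (a : ℚ) (ha : a ≠ 0) :
    qq * tt ^ m ≠ algebraMap (MvPolynomial (Fin 2) ℚ) FF (MvPolynomial.C a) := by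
  rw [qq, tt, ← map_pow, ← map_mul]
  intro h
  have h1 := IsFractionRing.injective (MvPolynomial (Fin 2) ℚ) FF h
  have h2 := congrArg (MvPolynomial.eval (0 : Fin 2 → ℚ)) h1
  simp [eq_comm, ha] at h2

lemma inner_coroot {V : Type*} [NormedAddCommGroup V] [InnerProductSpace ℝ V] (x α : V) :
    ⟪x, coroot α⟫ = 2 * ⟪x, α⟫ / ⟪α, α⟫ := by
  rw [coroot, real_inner_smul_right]
  ring

/-- For an admissible family, `c_μ - t^{ht(μ)}` scales by `t⁻¹` under a simple reflection lowering
the short root `μ`. -/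
lemma Admissible.mul_sub_sref {V : Type*} [NormedAddCommGroup V] [InnerProductSpace ℝ V]
    {S : RSD V} {θ : V} {c : V → FF} (hc : Admissible S θ c) {μ : V} (hμ : S.IsShort μ)
    (i : Fin S.n) (h : 0 < ⟪μ, S.simple i⟫) :
    tt * (c (sref (S.simple i) μ) - tt ^ S.htZ (sref (S.simple i) μ))
      = c μ - tt ^ S.htZ μ := by
  obtain ⟨hc0, hc1, -⟩ := hc
  rcases S.cartan_of_isShort hμ (S.simple_mem_R i) h with hk | ⟨rfl, hk⟩
  · have hht := S.htZ_sref_simple hμ.1 i (k := 1) (by simpa using hk)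
    have hrel := hc1 μ (S.inQ_of_root hμ.1) i 1 one_pos (by rw [inner_coroot, hk]; simp)
    simp only [Finset.Ico_self, Finset.sum_empty, mul_zero] at hrel
    rw [hht, mul_sub, ← zpow_one_add₀ tt_ne_zero, add_sub_cancel]
    linear_combination hrel
  · have hht := S.htZ_sref_simple hμ.1 i (k := 2) (by simpa using hk)
    have hrel := hc1 _ (S.inQ_of_root hμ.1) i 2 two_pos (by rw [inner_coroot, hk]; simp)
    simp only [Nat.Ico_succ_singleton, Finset.sum_singleton, Nat.cast_one, one_smul, sub_self,
      hc0] at hrel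
    rw [hht, mul_sub, ← zpow_one_add₀ tt_ne_zero, S.htZ_simple]
    norm_num
    linear_combination hrel


/-- Let `(c_λ)` be an admissible family and
`X = (1 − t⁻¹)/(1 − q·t^{ht(θ)})`. Then for every short root `λ`,
`c_λ = t^{ht(λ)+D_λ}·X + (t^{ht(λ)} − t^{ht(λ)+D_λ})`, where
`D_λ = ht(λ₊) − ht(λ) − ℓ(w_λ)`. -/
theorem admissible_coefficient_of_short_root
    {V : Type*} [NormedAddCommGroup V] [InnerProductSpace ℝ V]
    (S : RSD V)
    (θ : V) (hθ : θ ∈ S.R ∧ S.Dominant θ ∧ ∀ α ∈ S.R, S.htZ α ≤ S.htZ θ)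
    (c : V → FF) (hc : Admissible S θ c)
    (lam : V) (hshort : S.IsShort lam)
    (lamp : V) (hdom : S.Dominant lamp) (horb : S.sameOrbit lam lamp)
    (w : V → V) (hw : S.IsMinWord lamp lam w) :
    c lam
      = tt ^ (S.htZ lam + (S.htZ lamp - S.htZ lam - (S.len w : ℤ)))
            * ((1 - tt⁻¹) / (1 - qq * tt ^ (S.htZ θ)))
        + (tt ^ (S.htZ lam)
            - tt ^ (S.htZ lam + (S.htZ lamp - S.htZ lam - (S.len w : ℤ)))) := by
  obtain ⟨hθR, hθd, hθm⟩ := hθ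
  have hlamp : S.IsShort lamp := by
    obtain ⟨_, ⟨l, rfl⟩, rfl⟩ := horb
    exact S.isShort_wordMap hshort l
  have hchain := fun {μ : V} (hμ : S.IsShort μ) =>
    S.exists_word_of_isShort tt_ne_zero (fun x => c x - tt ^ S.htZ x)
      (fun μ hμ i h => hc.mul_sub_sref hμ i h) hθm hlamp hdom hμ
  have hlampPos := S.pos_of_dominant hlamp.1 hdom
  have hadj : S.adjHt lamp = S.htZ lamp := by simp [RSD.adjHt, hlampPos]
  have hlen : S.htZ lam + (S.htZ lamp - S.htZ lam - (S.len w : ℤ)) = S.adjHt lam := by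
    obtain ⟨l, hl, hll, -⟩ := hchain hshort
    obtain ⟨⟨l₀, hl₀⟩, hwl, hmin⟩ := hw
    have hle : S.len w ≤ l.length :=
      (hmin _ ⟨l, rfl⟩ hl).trans (Nat.sInf_le ⟨l, rfl, rfl⟩)
    obtain ⟨l₁, hl₁, hwl₁⟩ := Nat.sInf_mem
      (s := {k | ∃ l : List (Fin S.n), l.length = k ∧ w = S.wordMap l}) ⟨_, l₀, rfl, hl₀⟩
    have hge := S.adjHt_le_adjHt_wordMap_add_length hlamp l₁
    rw [← hwl₁, hwl, hl₁] at hge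
    change S.adjHt lamp ≤ S.adjHt lam + (S.len w : ℤ) at hge
    omega
  rw [hlen]
  have hθpos := S.pos_of_dominant hθR hθd
  obtain ⟨m, hm⟩ := Int.eq_ofNat_of_zero_le (S.htZ_pos hθpos).le
  have hne1 : qq * tt ^ m ≠ 1 := by simpa using qq_mul_tt_pow_ne_C m 1 one_ne_zero
  have hne2 : qq * tt ^ m ≠ -1 := by
    simpa using qq_mul_tt_pow_ne_C m (-1) (by norm_num)
  have ht := tt_ne_zero
  have hsub : (1 : FF) - qq * tt ^ m ≠ 0 := sub_ne_zero.2 hne1.symm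
  have htop : c lamp = tt ^ S.htZ lamp * ((1 - tt⁻¹) / (1 - qq * tt ^ S.htZ θ)) := by
    have hs := S.isShort_sref hlamp hθR
    obtain ⟨-, -, -, hν⟩ := hchain hs
    have hin := S.inner_pos_of_dominant hlamp.1 hθR hdom hθd
    obtain ⟨hc0, -, hc2⟩ := hc
    have hT : tt ^ m ≠ 0 := pow_ne_zero _ ht
    have hle := hθm lamp hlamp.1
    rcases S.cartan_of_isShort hlamp hθR hin with hk | ⟨rfl, hk⟩
    · have hht := S.htZ_sref hlamp.1 hθR (k := 1) (by simpa using hk)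
      have hneg : sref θ lamp ∉ S.Rpos := fun h => by
        have := S.htZ_pos h
        omega
      have hrel := hc2 lamp (S.inQ_of_root hlamp.1) 1 one_pos (by rw [inner_coroot, hk]; simp)
      simp only [Finset.Ico_self, Finset.sum_empty, mul_zero, pow_one] at hrel
      rw [RSD.adjHt, if_neg hneg, hadj, hht, hm, one_mul,
        show S.htZ lamp - (m : ℤ) + 1 - S.htZ lamp = 1 - (m : ℤ) by ring] at hν
      rw [hm]
      simp only [zpow_sub₀ ht, zpow_natCast, zpow_one] at hν ⊢
      generalize tt ^ S.htZ lamp = a at *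
      field_simp at hν ⊢
      rw [eq_div_iff (by rwa [mul_comm] at hsub)]
      linear_combination -hν - tt ^ m * hrel
    · have hht := S.htZ_sref hθR hθR (k := 2) (by simpa using hk)
      have hneg : sref lamp lamp ∉ S.Rpos := fun h => by
        have := S.htZ_pos h
        omega
      have hrel := hc2 lamp (S.inQ_of_root hlamp.1) 2 two_pos (by rw [inner_coroot, hk]; simp)
      simp only [Nat.Ico_succ_singleton, Finset.sum_singleton, Nat.cast_one, one_smul, sub_self,
        hc0] at hrel
      rw [RSD.adjHt, if_neg hneg, hadj, hht, hm,
        show (m : ℤ) - 2 * m + 1 - m = 1 - (m : ℤ) - m by ring,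
        show (m : ℤ) - 2 * m = 0 - (m : ℤ) by ring] at hν
      rw [hm]
      simp only [zpow_sub₀ ht, zpow_natCast, zpow_one, zpow_zero] at hν ⊢
      generalize tt ^ m = T at *
      field_simp at hν ⊢
      have hadd : 1 + T * qq ≠ 0 := fun h => hne2 (by linear_combination h)
      rw [eq_div_iff (by rwa [mul_comm] at hsub)]
      refine mul_right_cancel₀ hadd ?_
      linear_combination -hν - T ^ 2 * hrel
  obtain ⟨-, -, -, hf⟩ := hchain hshort
  rw [hadj, zpow_sub₀ ht, htop] at hf
  field_simp at hf ⊢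
  linear_combination hf

end
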